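/- arXiv:hep-th/0504006 — 2 statements merged into one kernel-verified Lean document; each statement's English description precedes it below -/
import Mathlib

section
/- Let k be a nonnegative integer, set K := k+12, M := K/gcd(K, 27720), and for integers a1, a2, a3, a4 set a0 := K - a1 - 2a2 - a3 - a4. Suppose there exist a transposition π of the three coordinates a1, a3, a4 (fixing a2) and a nontrivial simple current map J ∈ { (a1,a2,a3,a4) ↦ (a0,a2,a4,a3), (a1,a2,a3,a4) ↦ (a3,a2,a1,a0), (a1,a2,a3,a4) ↦ (a4,a2,a0,a1) } such that π(a1,a2,a3,a4) = J(a1,a2,a3,a4). Then N·M divides R(a1,a2,a3,a4); equivalently, dim_{F4}(b') ≡ 0 (mod M) for the corresponding F4 integral weight b'. -/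
/-- `R a1 a2 a3 a4` is `N = 2^15·3^7·5^4·7^2·11` times the formal `F₄` Weyl
dimension of the `F₄` integral weight whose corresponding level-`(k+6)` `D₄`
weight has finite Dynkin labels `b_i = a_i - 1`. -/
def R (a1 a2 a3 a4 : ℤ) : ℤ :=
  a1 * a2 * a3 * a4 * (a1 + a2) * (a1 + a3) * (a1 + a4) * (a2 + a3) * (a2 + a4) *
    (a3 + a4) * (a1 - a3) * (a1 - a4) * (a4 - a3) * (a1 + a2 + a3) * (a1 + a2 + a4) *
    (a2 + a3 + a4) * (a1 + a2 + a3 + a4) * (a1 + 2 * a2 + a3) * (a1 + 2 * a2 + a4) *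
    (2 * a2 + a3 + a4) * (a1 + 2 * a2 + a3 + a4) * (2 * a1 + 2 * a2 + a3 + a4) *
    (a1 + 2 * a2 + 2 * a3 + a4) * (a1 + 2 * a2 + a3 + 2 * a4)

/-- `N = 2^15·3^7·5^4·7^2·11` is the value of `R` at the zero `F₄` weight. -/
def Nf4 : ℤ := 2 ^ 15 * 3 ^ 7 * 5 ^ 4 * 7 ^ 2 * 11

/-- The first 21 factors of `R`. -/
def A0 (a1 a2 a3 a4 : ℤ) : ℤ :=
  a1 * a2 * a3 * a4 * (a1 + a2) * (a1 + a3) * (a1 + a4) * (a2 + a3) * (a2 + a4) *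
    (a3 + a4) * (a1 - a3) * (a1 - a4) * (a4 - a3) * (a1 + a2 + a3) * (a1 + a2 + a4) *
    (a2 + a3 + a4) * (a1 + a2 + a3 + a4) * (a1 + 2 * a2 + a3) * (a1 + 2 * a2 + a4) *
    (2 * a2 + a3 + a4) * (a1 + 2 * a2 + a3 + a4)

/-- The product of `gcd (factor, m)` over the 24 factors, on natural residues mod `m`. -/
def P (m a b c d : ℕ) : ℕ :=
  Nat.gcd a m * Nat.gcd b m * Nat.gcd c m * Nat.gcd d m * Nat.gcd (a + b) m *
    Nat.gcd (a + c) m * Nat.gcd (a + d) m * Nat.gcd (b + c) m * Nat.gcd (b + d) m *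
    Nat.gcd (c + d) m * Nat.gcd (a + (m - 1) * c) m * Nat.gcd (a + (m - 1) * d) m *
    Nat.gcd (d + (m - 1) * c) m * Nat.gcd (a + b + c) m * Nat.gcd (a + b + d) m *
    Nat.gcd (b + c + d) m * Nat.gcd (a + b + c + d) m * Nat.gcd (a + 2 * b + c) m *
    Nat.gcd (a + 2 * b + d) m * Nat.gcd (2 * b + c + d) m * Nat.gcd (a + 2 * b + c + d) m *
    Nat.gcd (2 * a + 2 * b + c + d) m * Nat.gcd (a + 2 * b + 2 * c + d) m *
    Nat.gcd (a + 2 * b + c + 2 * d) m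

/-- Bounded universal quantifier as a Boolean. -/
def allB (n : ℕ) (f : ℕ → Bool) : Bool :=
  Nat.rec true (fun i r => and (f i) r) n

theorem allB_spec (n : ℕ) (f : ℕ → Bool) (h : allB n f = true) : ∀ i < n, f i = true := by
  induction n with
  | zero => intro i hi; omega
  | succ k ih =>
    have h' : (f k && allB k f) = true := h
    rw [Bool.and_eq_true] at h'
    intro i hi
    rcases Nat.lt_succ_iff_lt_or_eq.mp hi with h1 | h1
    · exact ih h'.2 i h1
    · exact h1 ▸ h'.1

/-- Exhaustive check over residues. -/
def chk (m n : ℕ) : Bool :=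
  allB m fun a => allB m fun b => allB m fun c => allB m fun d => Nat.beq (P m a b c d % n) 0

theorem chk_spec (m n : ℕ) (h : chk m n = true) (a b c d : ℕ) (ha : a < m) (hb : b < m)
    (hc : c < m) (hd : d < m) : n ∣ P m a b c d := by
  have h1 := allB_spec _ _ (allB_spec _ _ (allB_spec _ _ (allB_spec _ _ h a ha) b hb) c hc) d hd
  exact Nat.dvd_of_mod_eq_zero (Nat.eq_of_beq_eq_true h1)

theorem chk8 : chk 8 (2 ^ 15) = true := by decide +kernel
theorem chk9 : chk 9 (3 ^ 7) = true := by decide +kernel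
theorem chk5 : chk 5 (5 ^ 4) = true := by decide +kernel
theorem chk7 : chk 7 (7 ^ 2) = true := by decide +kernel
theorem chk11 : chk 11 11 = true := by decide +kernel

theorem gcd_dvd_of (m f : ℕ) (X t : ℤ) (h : X = f + m * t) : ((Nat.gcd f m : ℕ) : ℤ) ∣ X := by
  rw [h]
  exact dvd_add (Int.natCast_dvd_natCast.mpr (Nat.gcd_dvd_left f m))
    (Dvd.dvd.mul_right (Int.natCast_dvd_natCast.mpr (Nat.gcd_dvd_right f m)) _)

theorem exists_res (m : ℕ) (hm : 0 < m) (a : ℤ) : ∃ r : ℕ, ∃ t : ℤ, r < m ∧ a = r + m * t := by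
  have hm' : (0 : ℤ) < m := by exact_mod_cast hm
  refine ⟨(a % m).toNat, a / m, ?_, ?_⟩
  · have := Int.emod_lt_of_pos a hm'
    have := Int.emod_nonneg a hm'.ne'
    omega
  · rw [Int.toNat_of_nonneg (Int.emod_nonneg a hm'.ne')]
    exact (Int.emod_add_mul_ediv a m).symm

theorem key (m n : ℕ) (hm : 0 < m) (h : chk m n = true) (a1 a2 a3 a4 u v w : ℤ)
    (hu : ∀ e : ℤ, e ∣ m → e ∣ 2 * a1 + 2 * a2 + a3 + a4 → e ∣ u)
    (hv : ∀ e : ℤ, e ∣ m → e ∣ a1 + 2 * a2 + 2 * a3 + a4 → e ∣ v)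
    (hw : ∀ e : ℤ, e ∣ m → e ∣ a1 + 2 * a2 + a3 + 2 * a4 → e ∣ w) :
    (n : ℤ) ∣ A0 a1 a2 a3 a4 * u * v * w := by
  obtain ⟨a, s, ha, rfl⟩ := exists_res m hm a1
  obtain ⟨b, t, hb, rfl⟩ := exists_res m hm a2
  obtain ⟨c, x, hc, rfl⟩ := exists_res m hm a3
  obtain ⟨d, y, hd, rfl⟩ := exists_res m hm a4
  refine (Int.natCast_dvd_natCast.mpr (chk_spec m n h a b c d ha hb hc hd)).trans ?_
  have hg : ∀ f : ℕ, ((Nat.gcd f m : ℕ) : ℤ) ∣ m := fun f =>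
    Int.natCast_dvd_natCast.mpr (Nat.gcd_dvd_right f m)
  have hm1 : ((m - 1 : ℕ) : ℤ) = m - 1 := by
    rw [Nat.cast_sub hm]; simp
  have hu' := hu _ (hg (2 * a + 2 * b + c + d))
    (gcd_dvd_of m _ _ (2 * s + 2 * t + x + y) (by push_cast; ring))
  have hv' := hv _ (hg (a + 2 * b + 2 * c + d))
    (gcd_dvd_of m _ _ (s + 2 * t + 2 * x + y) (by push_cast; ring))
  have hw' := hw _ (hg (a + 2 * b + c + 2 * d))
    (gcd_dvd_of m _ _ (s + 2 * t + x + 2 * y) (by push_cast; ring))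
  unfold P A0
  simp only [Nat.cast_mul]
  refine mul_dvd_mul (mul_dvd_mul (mul_dvd_mul ?_ hu') hv') hw'
  refine mul_dvd_mul (mul_dvd_mul (mul_dvd_mul (mul_dvd_mul (mul_dvd_mul (mul_dvd_mul (mul_dvd_mul (mul_dvd_mul (mul_dvd_mul (mul_dvd_mul (mul_dvd_mul (mul_dvd_mul (mul_dvd_mul (mul_dvd_mul (mul_dvd_mul (mul_dvd_mul (mul_dvd_mul (mul_dvd_mul (mul_dvd_mul (mul_dvd_mul ?_ ?_) ?_) ?_) ?_) ?_) ?_) ?_) ?_) ?_) ?_) ?_) ?_) ?_) ?_) ?_) ?_) ?_) ?_) ?_) ?_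
  · exact gcd_dvd_of m _ _ (s) (by ring)
  · exact gcd_dvd_of m _ _ (t) (by ring)
  · exact gcd_dvd_of m _ _ (x) (by ring)
  · exact gcd_dvd_of m _ _ (y) (by ring)
  · exact gcd_dvd_of m _ _ (s + t) (by push_cast; ring)
  · exact gcd_dvd_of m _ _ (s + x) (by push_cast; ring)
  · exact gcd_dvd_of m _ _ (s + y) (by push_cast; ring)
  · exact gcd_dvd_of m _ _ (t + x) (by push_cast; ring)
  · exact gcd_dvd_of m _ _ (t + y) (by push_cast; ring)
  · exact gcd_dvd_of m _ _ (x + y) (by push_cast; ring)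
  · exact gcd_dvd_of m _ _ (s - x - c) (by push_cast [hm1]; ring)
  · exact gcd_dvd_of m _ _ (s - y - d) (by push_cast [hm1]; ring)
  · exact gcd_dvd_of m _ _ (y - x - c) (by push_cast [hm1]; ring)
  · exact gcd_dvd_of m _ _ (s + t + x) (by push_cast; ring)
  · exact gcd_dvd_of m _ _ (s + t + y) (by push_cast; ring)
  · exact gcd_dvd_of m _ _ (t + x + y) (by push_cast; ring)
  · exact gcd_dvd_of m _ _ (s + t + x + y) (by push_cast; ring)
  · exact gcd_dvd_of m _ _ (s + 2 * t + x) (by push_cast; ring)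
  · exact gcd_dvd_of m _ _ (s + 2 * t + y) (by push_cast; ring)
  · exact gcd_dvd_of m _ _ (2 * t + x + y) (by push_cast; ring)
  · exact gcd_dvd_of m _ _ (s + 2 * t + x + y) (by push_cast; ring)

theorem key_all (a1 a2 a3 a4 u v w : ℤ)
    (hu : ∀ e : ℤ, e ∣ 27720 → e ∣ 2 * a1 + 2 * a2 + a3 + a4 → e ∣ u)
    (hv : ∀ e : ℤ, e ∣ 27720 → e ∣ a1 + 2 * a2 + 2 * a3 + a4 → e ∣ v)
    (hw : ∀ e : ℤ, e ∣ 27720 → e ∣ a1 + 2 * a2 + a3 + 2 * a4 → e ∣ w) :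
    Nf4 ∣ A0 a1 a2 a3 a4 * u * v * w := by
  have aux : ∀ m n : ℕ, 0 < m → (m : ℤ) ∣ 27720 → chk m n = true →
      (n : ℤ) ∣ A0 a1 a2 a3 a4 * u * v * w := fun m n hm hd h =>
    key m n hm h a1 a2 a3 a4 u v w (fun e he => hu e (he.trans hd))
      (fun e he => hv e (he.trans hd)) (fun e he => hw e (he.trans hd))
  have h8 := aux 8 _ (by norm_num) (by norm_num) chk8
  have h9 := aux 9 _ (by norm_num) (by norm_num) chk9
  have h5 := aux 5 _ (by norm_num) (by norm_num) chk5
  have h7 := aux 7 _ (by norm_num) (by norm_num) chk7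
  have h11 := aux 11 _ (by norm_num) (by norm_num) chk11
  generalize A0 a1 a2 a3 a4 * u * v * w = Z at *
  clear aux hu hv hw
  push_cast at h8 h9 h5 h7 h11
  have c1 : IsCoprime ((2 : ℤ) ^ 15) (3 ^ 7) := by
    rw [Int.isCoprime_iff_gcd_eq_one]; decide +kernel
  have c2 : IsCoprime ((2 : ℤ) ^ 15 * 3 ^ 7) (5 ^ 4) := by
    rw [Int.isCoprime_iff_gcd_eq_one]; decide +kernel
  have c3 : IsCoprime ((2 : ℤ) ^ 15 * 3 ^ 7 * 5 ^ 4) (7 ^ 2) := by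
    rw [Int.isCoprime_iff_gcd_eq_one]; decide +kernel
  have c4 : IsCoprime ((2 : ℤ) ^ 15 * 3 ^ 7 * 5 ^ 4 * 7 ^ 2) 11 := by
    rw [Int.isCoprime_iff_gcd_eq_one]; decide +kernel
  exact c4.mul_dvd (c3.mul_dvd (c2.mul_dvd (c1.mul_dvd h8 h9) h5) h7) h11

/-- If the level-`(k+3)` `F₄` weight `b'` (with shifted `D₄` labels
`(a1,a2,a3,a4)` and `a0 = K - a1 - 2a2 - a3 - a4`) satisfies `π b' = J b'`
for some transposition `π` of the coordinates `a1, a3, a4` and some nontrivial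
`D₄` simple current `J`, then its formal `F₄` Weyl dimension vanishes
mod `M_{F₄}`. -/
theorem F4_dim_vanishes_on_boundary (k : ℕ) (K M : ℤ)
    (hK : K = (k : ℤ) + 12) (hM : M = K / (Int.gcd K 27720 : ℤ))
    (a1 a2 a3 a4 a0 : ℤ) (ha0 : a0 = K - a1 - 2 * a2 - a3 - a4)
    (h : ∃ p ∈ ({(a3, a2, a1, a4), (a4, a2, a3, a1), (a1, a2, a4, a3)} :
          Set (ℤ × ℤ × ℤ × ℤ)),
        p ∈ ({(a0, a2, a4, a3), (a3, a2, a1, a0), (a4, a2, a0, a1)} :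
          Set (ℤ × ℤ × ℤ × ℤ))) :
    Nf4 * M ∣ R a1 a2 a3 a4 := by
  have hg : (Int.gcd K 27720 : ℤ) * M = K := by
    rw [hM]; exact Int.mul_ediv_cancel' (Int.gcd_dvd_left ..)
  have hR : R a1 a2 a3 a4 = A0 a1 a2 a3 a4 * (2 * a1 + 2 * a2 + a3 + a4) *
      (a1 + 2 * a2 + 2 * a3 + a4) * (a1 + 2 * a2 + a3 + 2 * a4) := rfl
  have hKg : ∀ e : ℤ, e ∣ 27720 → e ∣ K → e ∣ (Int.gcd K 27720 : ℤ) := fun e h1 h2 =>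
    Int.dvd_coe_gcd h2 h1
  have hk := key_all a1 a2 a3 a4
  rw [hR]
  clear hM hK hR
  generalize (Int.gcd K 27720 : ℤ) = g at *
  have hz : a1 = a3 ∨ a1 = a4 ∨ a4 = a3 → A0 a1 a2 a3 a4 = 0 := by
    unfold A0
    rintro (e | e | e) <;> rw [e] <;> simp
  generalize A0 a1 a2 a3 a4 = A at *
  have h1 : 2 * a1 + 2 * a2 + a3 + a4 = K → Nf4 * M ∣ A * (2 * a1 + 2 * a2 + a3 + a4) *
      (a1 + 2 * a2 + 2 * a3 + a4) * (a1 + 2 * a2 + a3 + 2 * a4) := by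
    intro e
    have := hk g _ _ (by rw [e]; exact hKg) (fun _ _ h => h) (fun _ _ h => h)
    refine (mul_dvd_mul_right this M).trans (dvd_of_eq ?_)
    rw [e, ← hg]; ring
  have h2 : a1 + 2 * a2 + 2 * a3 + a4 = K → Nf4 * M ∣ A * (2 * a1 + 2 * a2 + a3 + a4) *
      (a1 + 2 * a2 + 2 * a3 + a4) * (a1 + 2 * a2 + a3 + 2 * a4) := by
    intro e
    have := hk _ g _ (fun _ _ h => h) (by rw [e]; exact hKg) (fun _ _ h => h)
    refine (mul_dvd_mul_right this M).trans (dvd_of_eq ?_)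
    rw [e, ← hg]; ring
  have h3 : a1 + 2 * a2 + a3 + 2 * a4 = K → Nf4 * M ∣ A * (2 * a1 + 2 * a2 + a3 + a4) *
      (a1 + 2 * a2 + 2 * a3 + a4) * (a1 + 2 * a2 + a3 + 2 * a4) := by
    intro e
    have := hk _ _ g (fun _ _ h => h) (fun _ _ h => h) (by rw [e]; exact hKg)
    refine (mul_dvd_mul_right this M).trans (dvd_of_eq ?_)
    rw [e, ← hg]; ring
  have h0 : a1 = a3 ∨ a1 = a4 ∨ a4 = a3 → Nf4 * M ∣ A * (2 * a1 + 2 * a2 + a3 + a4) *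
      (a1 + 2 * a2 + 2 * a3 + a4) * (a1 + 2 * a2 + a3 + 2 * a4) := by
    intro e
    rw [hz e]; simp
  obtain ⟨p, hp, hq⟩ := h
  have hcase : (a1 = a3 ∨ a1 = a4 ∨ a4 = a3) ∨ 2 * a1 + 2 * a2 + a3 + a4 = K ∨
      a1 + 2 * a2 + 2 * a3 + a4 = K ∨ a1 + 2 * a2 + a3 + 2 * a4 = K := by
    simp only [Set.mem_insert_iff, Set.mem_singleton_iff] at hp hq
    rcases hp with rfl | rfl | rfl <;> simp only [Prod.mk.injEq] at hq <;> omega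
  rcases hcase with e | e | e | e
  · exact h0 e
  · exact h1 e
  · exact h2 e
  · exact h3 e
end

section
/- For all integers a1, a2, a3, a4, the integer N = 2^15·3^7·5^4·7^2·11 divides R(a1,a2,a3,a4); that is, the formal F4 Weyl dimension R(a1,a2,a3,a4)/N is an integer for every integral (not necessarily dominant) F4 weight. -/
/-- Bounded universal quantifier over `x < n` as a boolean. -/
def allBelow : ℕ → (ℕ → Bool) → Bool
  | 0, _ => true
  | n + 1, f => (f n) && (allBelow n f)

theorem allBelow_spec (n : ℕ) (f : ℕ → Bool) (h : allBelow n f = true) :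
    ∀ x < n, f x = true := by
  induction n with
  | zero => intro x hx; omega
  | succ k ih =>
    simp only [allBelow, Bool.and_eq_true] at h
    intro x hx
    rcases Nat.lt_succ_iff_lt_or_eq.mp hx with h1 | h1
    · exact ih h.2 x h1
    · rw [h1]; exact h.1

/-- Product of the gcds of the 24 factors with `m` (with `-1` replaced by `k = m - 1`). -/
def gcdProd (m k a b c d : ℕ) : ℕ :=
  a.gcd m * b.gcd m * c.gcd m * d.gcd m * (a + b).gcd m * (a + c).gcd m * (a + d).gcd m *
    (b + c).gcd m * (b + d).gcd m * (c + d).gcd m * (a + k * c).gcd m * (a + k * d).gcd m *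
    (d + k * c).gcd m * (a + b + c).gcd m * (a + b + d).gcd m * (b + c + d).gcd m *
    (a + b + c + d).gcd m * (a + 2 * b + c).gcd m * (a + 2 * b + d).gcd m *
    (2 * b + c + d).gcd m * (a + 2 * b + c + d).gcd m * (2 * a + 2 * b + c + d).gcd m *
    (a + 2 * b + 2 * c + d).gcd m * (a + 2 * b + c + 2 * d).gcd m

/-- The finite check over all residues modulo `m`. -/
def residueCheck (m k q : ℕ) : Bool :=
  allBelow m fun a => allBelow m fun b => allBelow m fun c => allBelow m fun d =>
    Nat.beq (gcdProd m k a b c d % q) 0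

theorem gcd_dvd_of_modEq (m f : ℕ) (g : ℤ) (h : (f : ℤ) ≡ g [ZMOD m]) :
    ((f.gcd m : ℕ) : ℤ) ∣ g := by
  have h1 : ((f.gcd m : ℕ) : ℤ) ∣ (f : ℤ) := by exact_mod_cast Nat.gcd_dvd_left f m
  have h2 : ((f.gcd m : ℕ) : ℤ) ∣ (m : ℤ) := by exact_mod_cast Nat.gcd_dvd_right f m
  have h3 := h2.trans h.dvd
  have h4 := dvd_add h3 h1
  simpa using h4

theorem dvd_R_of_check (m k q : ℕ) (hk : m = k + 1) (h : residueCheck m k q = true)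
    (a1 a2 a3 a4 : ℤ) : (q : ℤ) ∣ R a1 a2 a3 a4 := by
  have hm : (0 : ℤ) < m := by omega
  have key : ∀ z : ℤ, ∃ x : ℕ, x < m ∧ (x : ℤ) ≡ z [ZMOD m] := by
    intro z
    refine ⟨(z % m).toNat, ?_, ?_⟩
    · have := Int.emod_lt_of_pos z hm
      have := Int.emod_nonneg z hm.ne'
      omega
    · rw [Int.toNat_of_nonneg (Int.emod_nonneg z hm.ne')]
      exact Int.mod_modEq z m
  obtain ⟨a, ha, ea⟩ := key a1
  obtain ⟨b, hb, eb⟩ := key a2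
  obtain ⟨c, hc, ec⟩ := key a3
  obtain ⟨d, hd, ed⟩ := key a4
  have h0 := allBelow_spec _ _ (allBelow_spec _ _ (allBelow_spec _ _
    (allBelow_spec _ _ h a ha) b hb) c hc) d hd
  have h1 : q ∣ gcdProd m k a b c d := Nat.dvd_of_mod_eq_zero (Nat.eq_of_beq_eq_true h0)
  have h2 : (q : ℤ) ∣ (gcdProd m k a b c d : ℤ) := by exact_mod_cast h1
  refine h2.trans ?_
  have htwo : ∀ {x : ℕ} {z : ℤ}, (x : ℤ) ≡ z [ZMOD m] →
      ((2 * x : ℕ) : ℤ) ≡ 2 * z [ZMOD m] := by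
    intro x z e; push_cast; exact e.mul_left 2
  have hadd : ∀ {x y : ℕ} {z w : ℤ}, (x : ℤ) ≡ z [ZMOD m] → (y : ℤ) ≡ w [ZMOD m] →
      ((x + y : ℕ) : ℤ) ≡ z + w [ZMOD m] := by
    intro x y z w e f; push_cast; exact e.add f
  have hsub : ∀ {x y : ℕ} {z w : ℤ}, (x : ℤ) ≡ z [ZMOD m] → (y : ℤ) ≡ w [ZMOD m] →
      ((x + k * y : ℕ) : ℤ) ≡ z - w [ZMOD m] := by
    intro x y z w e f
    refine Int.ModEq.trans ?_ (e.sub f)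
    refine (Int.modEq_iff_dvd.mpr ⟨-y, ?_⟩)
    subst hk; push_cast; ring
  unfold gcdProd R
  simp only [Nat.cast_mul]
  repeat' apply mul_dvd_mul
  all_goals
    apply gcd_dvd_of_modEq
    first
    | assumption
    | exact hadd ‹_› ‹_›
    | exact hsub ‹_› ‹_›
    | (repeat' first | assumption | apply htwo | apply hsub | apply hadd)

theorem check_two : residueCheck 8 7 (2 ^ 15) = true := by decide +kernel
theorem check_three : residueCheck 9 8 (3 ^ 7) = true := by decide +kernel
theorem check_five : residueCheck 5 4 (5 ^ 4) = true := by decide +kernel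
theorem check_seven : residueCheck 7 6 (7 ^ 2) = true := by decide +kernel
theorem check_eleven : residueCheck 11 10 11 = true := by decide +kernel

/-- The formal `F₄` Weyl dimension `R a1 a2 a3 a4 / N` is an integer for every
integral (not necessarily dominant) `F₄` weight. -/
theorem F4_formal_dim_is_integer :
    ∀ a1 a2 a3 a4 : ℤ, (2 ^ 15 * 3 ^ 7 * 5 ^ 4 * 7 ^ 2 * 11 : ℤ) ∣ R a1 a2 a3 a4 := by
  intro a1 a2 a3 a4
  have h2 := dvd_R_of_check 8 7 (2 ^ 15) rfl check_two a1 a2 a3 a4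
  have h3 := dvd_R_of_check 9 8 (3 ^ 7) rfl check_three a1 a2 a3 a4
  have h5 := dvd_R_of_check 5 4 (5 ^ 4) rfl check_five a1 a2 a3 a4
  have h7 := dvd_R_of_check 7 6 (7 ^ 2) rfl check_seven a1 a2 a3 a4
  have h11 := dvd_R_of_check 11 10 11 rfl check_eleven a1 a2 a3 a4
  generalize R a1 a2 a3 a4 = r at h2 h3 h5 h7 h11 ⊢
  push_cast at h2 h3 h5 h7 h11
  refine IsCoprime.mul_dvd ?_ (IsCoprime.mul_dvd ?_ (IsCoprime.mul_dvd ?_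
    (IsCoprime.mul_dvd ?_ h2 h3) h5) h7) h11
  all_goals (rw [Int.isCoprime_iff_gcd_eq_one]; norm_num)
end
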